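/- For every preorder ℙ, the invariant 𝒦_ω(ℙ) belongs to spec(ℙ). -/

import Mathlib

universe u

/-- Two elements of a preorder are *compatible* if they have a common lower bound. -/
def PCompat {α : Type u} [Preorder α] (p q : α) : Prop := ∃ r, r ≤ p ∧ r ≤ q

/-- An *antichain*: a set of pairwise incompatible elements. -/
def PAntichain {α : Type u} [Preorder α] (A : Set α) : Prop :=
  A.Pairwise fun p q => ¬ PCompat p q

/-- The *cellularity* of a preorder: the supremum of ℵ₀ and the cardinalities of antichains. -/
noncomputable def cellularity (α : Type u) [Preorder α] : Cardinal.{u} :=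
  max Cardinal.aleph0
    (sSup {c : Cardinal.{u} | ∃ A : Set α, PAntichain A ∧ c = Cardinal.mk ↑A})

/-- The *cellular spectrum* of a preorder: the infinite cardinals κ such that the product
with any preorder of cellularity at most κ has cellularity at most κ. -/
def cellSpec (α : Type u) [Preorder α] : Set Cardinal.{u} :=
  {κ | Cardinal.aleph0 ≤ κ ∧
    ∀ (β : Type u) [Preorder β], cellularity β ≤ κ → cellularity (α × β) ≤ κ}

/-- A subset A of a preorder is *n-linked* if every n-element subset of A has a common
lower bound. -/
def NLinked {α : Type u} [Preorder α] (n : ℕ) (A : Set α) : Prop :=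
  ∀ F : Finset α, ↑F ⊆ A → F.card = n → ∃ r : α, ∀ p ∈ F, r ≤ p

/-- A subset is *centered* if it is n-linked for every n ≥ 2. -/
def PCentered {α : Type u} [Preorder α] (A : Set α) : Prop :=
  ∀ n : ℕ, 2 ≤ n → NLinked n A

/-- The invariant 𝒦_ω(α): the least infinite cardinal κ such that every subset of
cardinality κ⁺ has a centered subset of cardinality κ⁺. -/
noncomputable def knasterOmega (α : Type u) [Preorder α] : Cardinal.{u} :=
  sInf {κ : Cardinal.{u} | Cardinal.aleph0 ≤ κ ∧
    ∀ A : Set α, Cardinal.mk ↑A = Order.succ κ →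
      ∃ B ⊆ A, PCentered B ∧ Cardinal.mk ↑B = Order.succ κ}

theorem mk_le_cellularity_of_incompat {β : Type u} [Preorder β] {S : Type u} (f : S → β)
    (hf : ∀ s t, s ≠ t → ¬ PCompat (f s) (f t)) : Cardinal.mk S ≤ cellularity β := by
  have hinj : Function.Injective f := by
    intro s t hst
    by_contra hne
    exact hf s t hne ⟨f s, le_refl _, hst.le⟩
  have hanti : PAntichain (Set.range f) := by
    rintro _ ⟨s, rfl⟩ _ ⟨t, rfl⟩ hne
    exact hf s t (fun h => hne (by rw [h]))
  rw [← Cardinal.mk_range_eq f hinj]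
  refine le_trans ?_ (le_max_right _ _)
  refine le_csSup ⟨Cardinal.mk β, ?_⟩ ⟨_, hanti, rfl⟩
  rintro c ⟨A, -, rfl⟩
  exact Cardinal.mk_set_le A

/-- The invariant 𝒦_ω(ℙ) belongs to spec(ℙ). -/
theorem knasterOmega_mem_cellSpec {α : Type u} [Preorder α] :
    knasterOmega α ∈ cellSpec α := by
  have hne : {κ : Cardinal.{u} | Cardinal.aleph0 ≤ κ ∧
    ∀ A : Set α, Cardinal.mk ↑A = Order.succ κ →
      ∃ B ⊆ A, PCentered B ∧ Cardinal.mk ↑B = Order.succ κ}.Nonempty := by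
    refine ⟨max Cardinal.aleph0 (Cardinal.mk α), le_max_left _ _, fun A hA => ?_⟩
    exfalso
    have h1 := Cardinal.mk_set_le A
    rw [hA] at h1
    exact absurd (lt_of_lt_of_le (Order.lt_succ _) h1) (not_lt.2 (le_max_right _ _))
  have hmem := csInf_mem hne
  change Cardinal.aleph0 ≤ knasterOmega α ∧ ∀ A : Set α,
    Cardinal.mk ↑A = Order.succ (knasterOmega α) →
      ∃ B ⊆ A, PCentered B ∧ Cardinal.mk ↑B = Order.succ (knasterOmega α) at hmem
  generalize knasterOmega α = κ at hmem
  obtain ⟨hκ, hK⟩ := hmem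
  refine ⟨hκ, fun β _ hβ => max_le hκ (csSup_le' ?_)⟩
  rintro c ⟨A, hA, rfl⟩
  by_contra hlt
  have hfib : ∀ p : α, Cardinal.mk ((fun x : A => x.1.1) ⁻¹' {p}) ≤ κ := by
    intro p
    refine le_trans (mk_le_cellularity_of_incompat (fun x => x.1.1.2) ?_) hβ
    rintro ⟨⟨⟨p1, q1⟩, h1⟩, e1⟩ ⟨⟨⟨p2, q2⟩, h2⟩, e2⟩ hne ⟨r, hr1, hr2⟩
    simp only [Set.mem_preimage, Set.mem_singleton_iff] at e1 e2
    subst e1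
    subst e2
    refine hA h1 h2 (fun h => hne ?_) ⟨(p2, r), ⟨le_refl _, hr1⟩, ⟨le_refl _, hr2⟩⟩
    simpa using h
  have himg : Order.succ κ ≤ Cardinal.mk (Prod.fst '' A : Set α) := by
    rw [Order.succ_le_iff]
    by_contra hle
    apply hlt
    have h := Cardinal.mk_le_mk_mul_of_mk_preimage_le
      (fun x : A => (⟨x.1.1, x.1, x.2, rfl⟩ : (Prod.fst '' A : Set α))) (c := κ) (by
        rintro ⟨p, hp⟩
        refine le_trans (le_of_eq ?_) (hfib p)
        congr 2
        ext x
        exact Subtype.ext_iff)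
    exact h.trans ((mul_le_mul_left (not_lt.1 hle) κ).trans (Cardinal.mul_eq_self hκ).le)
  obtain ⟨C, hCA, hC⟩ := Cardinal.le_mk_iff_exists_subset.1 himg
  obtain ⟨B, hBC, hBc, hB⟩ := hK C hC
  have hch : ∀ b : B, ∃ q : β, (b.1, q) ∈ A := by
    intro b
    obtain ⟨⟨p, q⟩, hx, hp⟩ := hCA (hBC b.2)
    simp only at hp
    subst hp
    exact ⟨q, hx⟩
  choose q hq using hch
  have hle : Cardinal.mk B ≤ κ := by
    refine le_trans (mk_le_cellularity_of_incompat q ?_) hβ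
    rintro s t hne ⟨r, hr1, hr2⟩
    have hne' : s.1 ≠ t.1 := fun h => hne (Subtype.ext h)
    classical
    obtain ⟨z, hz⟩ := hBc 2 le_rfl {s.1, t.1} (by
      intro x hx
      simp only [Finset.coe_insert, Finset.coe_singleton, Set.mem_insert_iff,
        Set.mem_singleton_iff] at hx
      rcases hx with rfl | rfl
      · exact s.2
      · exact t.2) (Finset.card_pair hne')
    exact hA (hq s) (hq t) (fun h => hne' (congrArg Prod.fst h))
      ⟨(z, r), ⟨hz _ (by simp), hr1⟩, ⟨hz _ (by simp), hr2⟩⟩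
  rw [hB] at hle
  exact absurd (Order.lt_succ κ) (not_lt.2 hle)
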